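/- For all n, k, t ∈ ℕ with k ≤ n, the following identity holds in ℤ[q,q^{−1}]: Σ_{j=0}^{k} (−1)^{k−j} q^{(k−j)(k−j−1)/2} binom_q(k,j) ⟨q^{n−k+j}; t+j⟩_q ⟨q^{k+t}; k−j⟩_q = q^{k(k+t)} ⟨q^{n−k}; t⟩_q (q^{n−k−t}; k)_q. -/

import Mathlib

open Finset

noncomputable section

/-- The base field `ℚ(q)` of rational functions over `ℚ`. -/
abbrev K : Type := RatFunc ℚ

/-- The indeterminate `q`. -/
def q : K := RatFunc.X

/-- The `x`-number `(n)_x = (x^n - 1)/(x - 1)`. -/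
def qn (x : K) (n : ℕ) : K := (x ^ n - 1) / (x - 1)

/-- The `x`-factorial `(n)_x!`. -/
def qnFact (x : K) (n : ℕ) : K := ∏ r ∈ Finset.Icc 1 n, qn x r

/-- The `x`-binomial coefficient `binom_x(n,s)`, zero when `s > n`. -/
def qBinom (x : K) (n s : ℕ) : K :=
  if s ≤ n then qnFact x n / (qnFact x s * qnFact x (n - s)) else 0

/-- The balanced `q`-integer `[n]_q = (q^n - q^{-n})/(q - q^{-1})`. -/
def qint (n : ℕ) : K := (q ^ n - q⁻¹ ^ n) / (q - q⁻¹)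

/-- The balanced `q`-factorial `[n]_q!`. -/
def qintFact (n : ℕ) : K := ∏ r ∈ Finset.Icc 1 n, qint r

variable {A : Type*} [Ring A] [Algebra K A]

/-- The `q`-divided power `X^{(n)} = X^n / [n]_q!`. -/
def dp (X : A) (n : ℕ) : A := (qintFact n)⁻¹ • X ^ n

/-- The `q`-binomial coefficient `C_q(X; c, n) = ∏_{s=1}^n (q^{c+1-s} X - 1)/(q^s - 1)`. -/
def Cq (X : A) (c : ℤ) : ℕ → A
  | 0 => 1
  | n + 1 => (q ^ ((n : ℤ) + 1) - 1)⁻¹ • (Cq X c n * (q ^ (c - (n : ℤ)) • X - 1))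

/-- The bracket `{X; c | n, r} = Σ_{s=0}^r q^{s(s+1)/2} binom_q(r,s) C_q(X; c+s, n-r)`. -/
def Sq (X : A) (c : ℤ) (n r : ℕ) : A :=
  ∑ s ∈ Finset.range (r + 1),
    (q ^ (s * (s + 1) / 2) * qBinom q r s) • Cq X (c + (s : ℤ)) (n - r)

end

noncomputable section

/-- `⟨x; m⟩_q = ∏_{s=1}^{m} (x q^{1-s} + 1)`. -/
def qAngle (x : K) (m : ℕ) : K := ∏ s ∈ Finset.Icc 1 m, (x * q ^ (1 - (s : ℤ)) + 1)

/-- `(x; m)_q = ∏_{s=1}^{m} (x q^{1-s} - 1)`. -/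
def qParen (x : K) (m : ℕ) : K := ∏ s ∈ Finset.Icc 1 m, (x * q ^ (1 - (s : ℤ)) - 1)

theorem q_ne_zero : q ≠ 0 := RatFunc.X_ne_zero

theorem q_pow_ne_one {r : ℕ} (hr : r ≠ 0) : q ^ r ≠ 1 := by
  intro h
  have h' : algebraMap (Polynomial ℚ) K (Polynomial.X ^ r) = algebraMap (Polynomial ℚ) K 1 := by
    rw [map_pow, map_one, RatFunc.algebraMap_X]
    exact h
  have hdeg := congrArg Polynomial.natDegree (RatFunc.algebraMap_injective ℚ h')
  rw [Polynomial.natDegree_X_pow, Polynomial.natDegree_one] at hdeg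
  exact hr hdeg

theorem q_sub_one_ne_zero : q - 1 ≠ 0 := by
  simpa [sub_eq_zero] using q_pow_ne_one one_ne_zero

theorem qn_q_ne_zero {r : ℕ} (hr : r ≠ 0) : qn q r ≠ 0 :=
  div_ne_zero (sub_ne_zero.2 (q_pow_ne_one hr)) q_sub_one_ne_zero

theorem qnFact_succ (x : K) (n : ℕ) : qnFact x (n + 1) = qnFact x n * qn x (n + 1) :=
  Finset.prod_Icc_succ_top (by omega) _

theorem qnFact_q_ne_zero (n : ℕ) : qnFact q n ≠ 0 :=
  Finset.prod_ne_zero_iff.2 fun r hr => qn_q_ne_zero (by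
    have := (Finset.mem_Icc.1 hr).1
    omega)

theorem qn_add (x : K) (m n : ℕ) : qn x (m + n) = x ^ m * qn x n + qn x m := by
  unfold qn
  ring

theorem qBinom_zero_right (n : ℕ) : qBinom q n 0 = 1 := by
  simp [qBinom, qnFact_q_ne_zero n, show qnFact q 0 = 1 from rfl]

theorem qBinom_self (n : ℕ) : qBinom q n n = 1 := by
  simp [qBinom, qnFact_q_ne_zero n, show qnFact q 0 = 1 from rfl]

theorem qBinom_eq_zero (x : K) {n s : ℕ} (h : n < s) : qBinom x n s = 0 :=
  if_neg (by omega)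

/-- The `q`-Pascal rule. -/
theorem qBinom_succ_succ {n s : ℕ} (h : s ≤ n) :
    qBinom q (n + 1) (s + 1) = q ^ (n - s) * qBinom q n s + qBinom q n (s + 1) := by
  obtain ⟨d, rfl⟩ := Nat.exists_eq_add_of_le h
  rcases d with _ | d
  · simp [qBinom_self, qBinom_eq_zero q (Nat.lt_succ_self s)]
  · have e₁ : s + (d + 1) + 1 - (s + 1) = d + 1 := by omega
    have e₂ : s + (d + 1) - s = d + 1 := by omega
    have e₃ : s + (d + 1) - (s + 1) = d := by omega
    have hn : qn q (s + (d + 1) + 1) = q ^ (d + 1) * qn q (s + 1) + qn q (d + 1) := by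
      rw [← qn_add]
      congr 1
      omega
    rw [qBinom, qBinom, qBinom, if_pos (by omega), if_pos (by omega), if_pos (by omega), e₁, e₂, e₃,
      qnFact_succ q (s + (d + 1)), hn, qnFact_succ q s, qnFact_succ q d]
    have hs := qnFact_q_ne_zero s
    have hd := qnFact_q_ne_zero d
    have hs' := qn_q_ne_zero (Nat.succ_ne_zero s)
    have hd' := qn_q_ne_zero (Nat.succ_ne_zero d)
    rw [Nat.succ_eq_add_one] at hs' hd'
    generalize qn q (s + 1) = a at *
    generalize qn q (d + 1) = b at *
    field_simp

theorem sum_qBinom_succ_mul (k : ℕ) (f : ℕ → K) :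
    ∑ j ∈ Finset.range (k + 2), qBinom q (k + 1) j * f j =
      ∑ j ∈ Finset.range (k + 1), qBinom q k j * (q ^ (k - j) * f (j + 1) + f j) := by
  have hsum : ∑ j ∈ Finset.range (k + 1), qBinom q k (j + 1) * f (j + 1) + f 0 =
      ∑ j ∈ Finset.range (k + 1), qBinom q k j * f j := by
    have h := Finset.sum_range_succ' (fun j => qBinom q k j * f j) (k + 1)
    rw [Finset.sum_range_succ, qBinom_eq_zero q (Nat.lt_succ_self k), qBinom_zero_right] at h
    simpa using h.symm
  rw [Finset.sum_range_succ', qBinom_zero_right, one_mul]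
  simp only [mul_add, Finset.sum_add_distrib]
  rw [← hsum, ← add_assoc, ← Finset.sum_add_distrib]
  congr 1
  refine Finset.sum_congr rfl fun j hj => ?_
  rw [qBinom_succ_succ (Nat.lt_succ_iff.1 (Finset.mem_range.1 hj))]
  ring

/-- A polynomial form of the `q`-Chu–Vandermonde identity. -/
theorem sum_qBinom_mul_prod_mul_prod (x z : K) (k : ℕ) :
    ∑ j ∈ Finset.range (k + 1), qBinom q k j * ((-1) ^ (k - j) *
        (∏ i ∈ Finset.range j, (x * q ^ (i + 1) + 1)) *
          ∏ i ∈ Finset.range (k - j), (z + q ^ i)) =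
      ∏ i ∈ Finset.range k, (x * q ^ (i + 1) - z) := by
  induction k with
  | zero => simp [qBinom_zero_right]
  | succ k ih =>
    rw [sum_qBinom_succ_mul, Finset.prod_range_succ, ← ih, Finset.sum_mul]
    refine Finset.sum_congr rfl fun j hj => ?_
    obtain ⟨d, rfl⟩ := Nat.exists_eq_add_of_le (Nat.lt_succ_iff.1 (Finset.mem_range.1 hj))
    have e₁ : j + d + 1 - (j + 1) = d := by omega
    have e₂ : j + d + 1 - j = d + 1 := by omega
    rw [e₁, e₂, Nat.add_sub_cancel_left, Finset.prod_range_succ, Finset.prod_range_succ]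
    ring

theorem qAngle_eq_prod_range (x : K) (m : ℕ) :
    qAngle x m = ∏ i ∈ Finset.range m, (x * q ^ (-(i : ℤ)) + 1) := by
  rw [qAngle, Finset.range_eq_Ico, ← Finset.Ico_add_one_right_eq_Icc,
    ← Finset.prod_Ico_add' _ 0 m 1]
  refine Finset.prod_congr rfl fun i _ => ?_
  push_cast
  congr 3
  ring

theorem qParen_eq_prod_range (x : K) (m : ℕ) :
    qParen x m = ∏ i ∈ Finset.range m, (x * q ^ (-(i : ℤ)) - 1) := by
  rw [qParen, Finset.range_eq_Ico, ← Finset.Ico_add_one_right_eq_Icc,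
    ← Finset.prod_Ico_add' _ 0 m 1]
  refine Finset.prod_congr rfl fun i _ => ?_
  push_cast
  congr 3
  ring

theorem qAngle_zpow_add (a : ℤ) (t j : ℕ) :
    qAngle (q ^ (a + j)) (t + j) =
      qAngle (q ^ a) t * ∏ i ∈ Finset.range j, (q ^ a * q ^ (i + 1) + 1) := by
  induction j with
  | zero => simp
  | succ j ih =>
    rw [Finset.prod_range_succ, ← mul_assoc, ← ih, ← add_assoc t j 1, qAngle_eq_prod_range,
      Finset.prod_range_succ', qAngle_eq_prod_range]
    congr 1
    · refine Finset.prod_congr rfl fun i _ => ?_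
      rw [← zpow_add₀ q_ne_zero, ← zpow_add₀ q_ne_zero]
      congr 2
      push_cast
      ring
    · rw [zpow_add₀ q_ne_zero, zpow_natCast]
      simp

theorem q_pow_mul_qAngle (z : K) (m : ℕ) :
    q ^ (m * (m - 1) / 2) * qAngle z m = ∏ i ∈ Finset.range m, (z + q ^ i) := by
  rw [← Finset.sum_range_id, ← Finset.prod_pow_eq_pow_sum, qAngle_eq_prod_range,
    ← Finset.prod_mul_distrib]
  refine Finset.prod_congr rfl fun i _ => ?_
  have := pow_ne_zero i q_ne_zero
  rw [zpow_neg, zpow_natCast]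
  field_simp

theorem q_pow_mul_qParen (a : ℤ) (k t : ℕ) :
    q ^ (k * (k + t)) * qParen (q ^ (a - t)) k =
      ∏ i ∈ Finset.range k, (q ^ a * q ^ (i + 1) - q ^ ((k : ℤ) + t)) := by
  rw [mul_comm k, pow_mul, qParen_eq_prod_range, ← Finset.prod_range_reflect]
  nth_rewrite 2 [← Finset.card_range k]
  rw [← Finset.prod_const, ← Finset.prod_mul_distrib]
  refine Finset.prod_congr rfl fun i hi => ?_
  have hi' := Finset.mem_range.1 hi
  rw [← zpow_natCast, ← zpow_natCast q (i + 1), mul_sub, mul_one, ← zpow_add₀ q_ne_zero,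
    ← zpow_add₀ q_ne_zero, ← zpow_add₀ q_ne_zero]
  have e : ((k - 1 - i : ℕ) : ℤ) = k - 1 - i := by omega
  rw [e]
  congr 2
  push_cast
  ring

theorem statement11 (n k t : ℕ) (hk : k ≤ n) :
    ∑ j ∈ Finset.range (k + 1),
        (-1 : K) ^ (k - j) * q ^ ((k - j) * (k - j - 1) / 2) * qBinom q k j *
          qAngle (q ^ ((n : ℤ) - k + j)) (t + j) * qAngle (q ^ ((k : ℤ) + t)) (k - j) =
      q ^ (k * (k + t)) * qAngle (q ^ ((n : ℤ) - k)) t * qParen (q ^ ((n : ℤ) - k - t)) k := by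
  rw [mul_right_comm, q_pow_mul_qParen, ← sum_qBinom_mul_prod_mul_prod, Finset.sum_mul]
  refine Finset.sum_congr rfl fun j _ => ?_
  rw [qAngle_zpow_add, ← q_pow_mul_qAngle]
  ring

end
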